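/- arXiv:2103.10067 — 5 statements merged into one kernel-verified Lean document; each statement's English description precedes it below -/
import Mathlib

section
/- Let (𝔠ₖ = [aₖ,bₖ])_{1≤k≤l} be an admissible chain of i-boxes with envelopes 𝔠̃ₖ = [ãₖ,b̃ₖ]. Then: (i) for every finite k ≤ l one has (aₖ)⁻ < ãₖ ≤ b̃ₖ < (bₖ)⁺; (ii) for all finite 1 ≤ j ≤ k ≤ l one has (aₖ)⁻ < aⱼ ≤ bⱼ < (bₖ)⁺; in particular any two i-boxes 𝔠ⱼ and 𝔠ₖ of the chain commute. -/
open Set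

variable {I : Type*}

/-- Every fiber of `ι` is unbounded above and unbounded below. -/
def FibersUnbounded (ι : ℤ → I) : Prop :=
  ∀ i : I, ∀ n : ℤ, (∃ k, n < k ∧ ι k = i) ∧ (∃ k, k < n ∧ ι k = i)

/-- `s⁺ = min {t | s < t, ι t = ι s}`. -/
noncomputable def splus (ι : ℤ → I) (s : ℤ) : ℤ := sInf {t : ℤ | s < t ∧ ι t = ι s}

/-- `s⁻ = max {t | t < s, ι t = ι s}`. -/
noncomputable def sminus (ι : ℤ → I) (s : ℤ) : ℤ := sSup {t : ℤ | t < s ∧ ι t = ι s}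

/-- `s(j)⁺ = min {t | s ≤ t, ι t = j}`. -/
noncomputable def jplus (ι : ℤ → I) (s : ℤ) (j : I) : ℤ := sInf {t : ℤ | s ≤ t ∧ ι t = j}

/-- `s(j)⁻ = max {t | t ≤ s, ι t = j}`. -/
noncomputable def jminus (ι : ℤ → I) (s : ℤ) (j : I) : ℤ := sSup {t : ℤ | t ≤ s ∧ ι t = j}

/-- `[a,b]` is an i-box: `a ≤ b` and `ι a = ι b`. -/
def IsIBox (ι : ℤ → I) (a b : ℤ) : Prop := a ≤ b ∧ ι a = ι b

/-- Two i-boxes `[a₁,b₁]` and `[a₂,b₂]` commute. -/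
def BoxCommute (ι : ℤ → I) (a₁ b₁ a₂ b₂ : ℤ) : Prop :=
  (sminus ι a₁ < a₂ ∧ a₂ ≤ b₂ ∧ b₂ < splus ι b₁) ∨
  (sminus ι a₂ < a₁ ∧ a₁ ≤ b₁ ∧ b₁ < splus ι b₂)

/-- The envelope set `𝔠̃ₖ = ⋃_{1 ≤ j ≤ k} [aⱼ,bⱼ]` of the first `k` boxes of a chain. -/
def envSet (a b : ℕ → ℤ) (k : ℕ) : Set ℤ := ⋃ j ∈ Set.Icc 1 k, Set.Icc (a j) (b j)

/-- `ãₖ`, the left endpoint of the envelope. -/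
noncomputable def envA (a b : ℕ → ℤ) (k : ℕ) : ℤ := sInf (envSet a b k)

/-- `b̃ₖ`, the right endpoint of the envelope. -/
noncomputable def envB (a b : ℕ → ℤ) (k : ℕ) : ℤ := sSup (envSet a b k)

/-- A chain of i-boxes `(𝔠ₖ = [a k, b k])_{1 ≤ k ≤ l}`, `l ∈ ℤ≥1 ∪ {∞}`, is admissible if
for every finite `k ≤ l` the envelope is an interval `[ãₖ, b̃ₖ]` with exactly `k` elements and
`𝔠ₖ = [ãₖ,b̃ₖ}` or `𝔠ₖ = {ãₖ,b̃ₖ]`. -/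
def IsAdmissibleChain (ι : ℤ → I) (l : ℕ∞) (a b : ℕ → ℤ) : Prop :=
  ∀ k : ℕ, 1 ≤ k → (k : ℕ∞) ≤ l →
    IsIBox ι (a k) (b k) ∧
    envSet a b k = Set.Icc (envA a b k) (envB a b k) ∧
    envB a b k + 1 = envA a b k + (k : ℤ) ∧
    ((a k = envA a b k ∧ b k = jminus ι (envB a b k) (ι (envA a b k))) ∨
     (a k = jplus ι (envA a b k) (ι (envB a b k)) ∧ b k = envB a b k))

/-- The range `⋃_{1 ≤ k ≤ l} 𝔠ₖ` of a chain. -/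
def chainRange (l : ℕ∞) (a b : ℕ → ℤ) : Set ℤ :=
  ⋃ k ∈ {k : ℕ | 1 ≤ k ∧ (k : ℕ∞) ≤ l}, Set.Icc (a k) (b k)

theorem FibersUnbounded.isGreatest_sminus {ι : ℤ → I} (hub : FibersUnbounded ι) (s : ℤ) :
    IsGreatest {t : ℤ | t < s ∧ ι t = ι s} (sminus ι s) := by
  have hbdd : BddAbove {t : ℤ | t < s ∧ ι t = ι s} := ⟨s, fun t ht => ht.1.le⟩
  exact ⟨Int.csSup_mem (hub (ι s) s).2 hbdd, fun t ht => le_csSup hbdd ht⟩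

theorem FibersUnbounded.isLeast_splus {ι : ℤ → I} (hub : FibersUnbounded ι) (s : ℤ) :
    IsLeast {t : ℤ | s < t ∧ ι t = ι s} (splus ι s) := by
  have hbdd : BddBelow {t : ℤ | s < t ∧ ι t = ι s} := ⟨s, fun t ht => ht.1.le⟩
  exact ⟨Int.csInf_mem (hub (ι s) s).1 hbdd, fun t ht => csInf_le hbdd ht⟩

theorem lt_splus_jminus {ι : ℤ → I} (hub : FibersUnbounded ι) (s : ℤ) (j : I) :
    s < splus ι (jminus ι s j) := by
  have hbdd : BddAbove {t : ℤ | t ≤ s ∧ ι t = j} := ⟨s, fun t ht => ht.1⟩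
  obtain ⟨k, hk, hkj⟩ := (hub j s).2
  have hmem : jminus ι s j ∈ {t : ℤ | t ≤ s ∧ ι t = j} :=
    Int.csSup_mem ⟨k, hk.le, hkj⟩ hbdd
  obtain ⟨hlt, heq⟩ := (hub.isLeast_splus (jminus ι s j)).1
  by_contra! hle
  exact hlt.not_ge (le_csSup hbdd ⟨hle, heq.trans hmem.2⟩)

theorem sminus_jplus_lt {ι : ℤ → I} (hub : FibersUnbounded ι) (s : ℤ) (j : I) :
    sminus ι (jplus ι s j) < s := by
  have hbdd : BddBelow {t : ℤ | s ≤ t ∧ ι t = j} := ⟨s, fun t ht => ht.1⟩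
  obtain ⟨k, hk, hkj⟩ := (hub j s).1
  have hmem : jplus ι s j ∈ {t : ℤ | s ≤ t ∧ ι t = j} :=
    Int.csInf_mem ⟨k, hk.le, hkj⟩ hbdd
  obtain ⟨hlt, heq⟩ := (hub.isGreatest_sminus (jplus ι s j)).1
  by_contra! hle
  exact hlt.not_ge (csInf_le hbdd ⟨hle, heq.trans hmem.2⟩)

theorem stmt0 (ι : ℤ → I) (hub : FibersUnbounded ι)
    (l : ℕ∞) (a b : ℕ → ℤ) (h : IsAdmissibleChain ι l a b) :
    (∀ k : ℕ, 1 ≤ k → (k : ℕ∞) ≤ l →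
      sminus ι (a k) < envA a b k ∧ envA a b k ≤ envB a b k ∧ envB a b k < splus ι (b k)) ∧
    (∀ j k : ℕ, 1 ≤ j → j ≤ k → (k : ℕ∞) ≤ l →
      sminus ι (a k) < a j ∧ a j ≤ b j ∧ b j < splus ι (b k) ∧
      BoxCommute ι (a j) (b j) (a k) (b k)) := by
  have henv : ∀ k : ℕ, 1 ≤ k → (k : ℕ∞) ≤ l →
      sminus ι (a k) < envA a b k ∧ envA a b k ≤ envB a b k ∧
        envB a b k < splus ι (b k) := by
    intro k hk hkl
    obtain ⟨-, -, hcard, hbox⟩ := h k hk hkl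
    have hle : envA a b k ≤ envB a b k := by omega
    rcases hbox with ⟨ha, hb⟩ | ⟨ha, hb⟩
    · refine ⟨?_, hle, ?_⟩
      · rw [ha]
        exact (hub.isGreatest_sminus _).1.1
      · rw [hb]
        exact lt_splus_jminus hub _ _
    · refine ⟨?_, hle, ?_⟩
      · rw [ha]
        exact sminus_jplus_lt hub _ _
      · rw [hb]
        exact (hub.isLeast_splus _).1.1
  refine ⟨henv, fun j k hj hjk hkl => ?_⟩
  obtain ⟨hA, -, hB⟩ := henv k (hj.trans hjk) hkl
  have hab : a j ≤ b j := (h j hj ((Nat.cast_le.mpr hjk).trans hkl)).1.1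
  have hsub : Icc (a j) (b j) ⊆ Icc (envA a b k) (envB a b k) := by
    rw [← (h k (hj.trans hjk) hkl).2.1]
    exact subset_biUnion_of_mem (u := fun i => Icc (a i) (b i)) (show j ∈ Icc 1 k from ⟨hj, hjk⟩)
  have ha := hA.trans_le (hsub (left_mem_Icc.mpr hab)).1
  have hb := (hsub (right_mem_Icc.mpr hab)).2.trans_lt hB
  exact ⟨ha, hab, hb, Or.inr ⟨ha, hab, hb⟩⟩
end

section
/- Let (𝔠ₖ)_{1≤k≤l} be an admissible chain of i-boxes and let [a,b] be an i-box contained in the range of the chain such that [a,b] commutes with 𝔠ₖ for every finite 1 ≤ k ≤ l. Then [a,b] is a member of the chain, i.e. [a,b] = 𝔠ₛ for some 1 ≤ s ≤ l. -/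
open Set

variable {I : Type*}

theorem splus_mem {ι : ℤ → I} (hub : FibersUnbounded ι) (s : ℤ) :
    s < splus ι s ∧ ι (splus ι s) = ι s :=
  Int.csInf_mem (s := {t : ℤ | s < t ∧ ι t = ι s}) (hub (ι s) s).1 ⟨s, fun _ ht => ht.1.le⟩

theorem splus_le {ι : ℤ → I} {s t : ℤ} (hst : s < t) (ht : ι t = ι s) : splus ι s ≤ t :=
  csInf_le (s := {t : ℤ | s < t ∧ ι t = ι s}) ⟨s, fun _ h => h.1.le⟩ ⟨hst, ht⟩

theorem sminus_mem {ι : ℤ → I} (hub : FibersUnbounded ι) (s : ℤ) :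
    sminus ι s < s ∧ ι (sminus ι s) = ι s :=
  Int.csSup_mem (s := {t : ℤ | t < s ∧ ι t = ι s}) (hub (ι s) s).2 ⟨s, fun _ ht => ht.1.le⟩

theorem le_sminus {ι : ℤ → I} {s t : ℤ} (hts : t < s) (ht : ι t = ι s) : t ≤ sminus ι s :=
  le_csSup (s := {t : ℤ | t < s ∧ ι t = ι s}) ⟨s, fun _ h => h.1.le⟩ ⟨hts, ht⟩

theorem jplus_le {ι : ℤ → I} {s t : ℤ} {j : I} (hst : s ≤ t) (ht : ι t = j) : jplus ι s j ≤ t :=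
  csInf_le (s := {t : ℤ | s ≤ t ∧ ι t = j}) ⟨s, fun _ h => h.1⟩ ⟨hst, ht⟩

theorem le_jminus {ι : ℤ → I} {s t : ℤ} {j : I} (hts : t ≤ s) (ht : ι t = j) : t ≤ jminus ι s j :=
  le_csSup (s := {t : ℤ | t ≤ s ∧ ι t = j}) ⟨s, fun _ h => h.1⟩ ⟨hts, ht⟩

theorem mem_envSet {a b : ℕ → ℤ} {k : ℕ} {z : ℤ} :
    z ∈ envSet a b k ↔ ∃ j, 1 ≤ j ∧ j ≤ k ∧ a j ≤ z ∧ z ≤ b j := by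
  simp only [envSet, mem_iUnion, mem_Icc, exists_prop, and_assoc]

theorem envSet_mono (a b : ℕ → ℤ) : Monotone (envSet a b) := fun m n hmn z hz => by
  obtain ⟨j, h1, hj, hz⟩ := mem_envSet.1 hz
  exact mem_envSet.2 ⟨j, h1, hj.trans hmn, hz⟩

namespace IsAdmissibleChain

variable {ι : ℤ → I} {l : ℕ∞} {a b : ℕ → ℤ}

theorem mem_envSet_iff (h : IsAdmissibleChain ι l a b) {k : ℕ} (hk : 1 ≤ k) (hkl : (k : ℕ∞) ≤ l)
    {z : ℤ} : z ∈ envSet a b k ↔ envA a b k ≤ z ∧ z ≤ envB a b k := by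
  conv_lhs => rw [(h k hk hkl).2.1]
  exact mem_Icc

theorem box_mem_envSet (h : IsAdmissibleChain ι l a b) {k : ℕ} (hk : 1 ≤ k) (hkl : (k : ℕ∞) ≤ l) :
    a k ∈ envSet a b k ∧ b k ∈ envSet a b k :=
  have hab := (h k hk hkl).1.1
  ⟨mem_envSet.2 ⟨k, hk, le_rfl, le_rfl, hab⟩, mem_envSet.2 ⟨k, hk, le_rfl, hab, le_rfl⟩⟩

/-- A point of the `k`-th envelope which is not in the previous one is a common endpoint of the
`k`-th envelope and the `k`-th box, and all other points are in the previous envelope. -/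
theorem new_point (h : IsAdmissibleChain ι l a b) {k : ℕ} (hkl : ((k + 1 : ℕ) : ℕ∞) ≤ l) {z : ℤ}
    (hz : z ∈ envSet a b (k + 1)) (hz' : z ∉ envSet a b k) :
    (z = a (k + 1) ∧ z = envA a b (k + 1) ∨ z = b (k + 1) ∧ z = envB a b (k + 1)) ∧
      ∀ w ∈ envSet a b (k + 1), w ≠ z → w ∈ envSet a b k := by
  have hk1 : 1 ≤ k + 1 := by omega
  obtain ⟨j, hj, hjk, hzj⟩ := mem_envSet.1 hz
  obtain rfl : j = k + 1 := by
    by_contra hne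
    exact hz' (mem_envSet.2 ⟨j, hj, by omega, hzj⟩)
  have hcard := (h _ hk1 hkl).2.2.1
  have hbox := h.box_mem_envSet hk1 hkl
  simp only [h.mem_envSet_iff hk1 hkl] at hz hbox ⊢
  rcases Nat.eq_zero_or_pos k with rfl | hk
  · exact ⟨by omega, fun w hw hne => absurd (by omega) hne⟩
  · have hkl' : (k : ℕ∞) ≤ l := le_trans (by exact_mod_cast k.le_succ) hkl
    have hcard' := (h k hk hkl').2.2.1
    have hA : envA a b k ∈ envSet a b k := (h.mem_envSet_iff hk hkl').2 ⟨le_rfl, by omega⟩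
    have hB : envB a b k ∈ envSet a b k := (h.mem_envSet_iff hk hkl').2 ⟨by omega, le_rfl⟩
    replace hA := (h.mem_envSet_iff hk1 hkl).1 (envSet_mono a b k.le_succ hA)
    replace hB := (h.mem_envSet_iff hk1 hkl).1 (envSet_mono a b k.le_succ hB)
    simp only [h.mem_envSet_iff hk hkl'] at hz' ⊢
    exact ⟨by omega, fun w hw hne => by omega⟩

/-- Every point of an envelope is an endpoint of one of its boxes. -/
theorem exists_endpoint (h : IsAdmissibleChain ι l a b) {z : ℤ} :
    ∀ {k : ℕ}, (k : ℕ∞) ≤ l → z ∈ envSet a b k →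
      ∃ t, 1 ≤ t ∧ t ≤ k ∧ (t : ℕ∞) ≤ l ∧ (z = a t ∨ z = b t)
  | 0, _, hz => by
    obtain ⟨j, h1, h0, _⟩ := mem_envSet.1 hz
    omega
  | k + 1, hkl, hz => by
    by_cases hz' : z ∈ envSet a b k
    · obtain ⟨t, h1, htk, ht⟩ :=
        h.exists_endpoint (le_trans (by exact_mod_cast k.le_succ) hkl) hz'
      exact ⟨t, h1, by omega, ht⟩
    · exact ⟨k + 1, by omega, le_rfl, hkl, (h.new_point hkl hz hz').1.imp And.left And.left⟩

end IsAdmissibleChain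

theorem stmt1 (ι : ℤ → I) (hub : FibersUnbounded ι)
    (l : ℕ∞) (a b : ℕ → ℤ) (h : IsAdmissibleChain ι l a b)
    (x y : ℤ) (hbox : IsIBox ι x y)
    (hsub : Set.Icc x y ⊆ chainRange l a b)
    (hcomm : ∀ k : ℕ, 1 ≤ k → (k : ℕ∞) ≤ l → BoxCommute ι x y (a k) (b k)) :
    ∃ s : ℕ, 1 ≤ s ∧ (s : ℕ∞) ≤ l ∧ a s = x ∧ b s = y := by
  obtain ⟨hxy, hιxy⟩ := hbox
  have hex : ∃ s : ℕ, (s : ℕ∞) ≤ l ∧ x ∈ envSet a b s ∧ y ∈ envSet a b s := by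
    have hx := hsub (left_mem_Icc.2 hxy)
    have hy := hsub (right_mem_Icc.2 hxy)
    simp only [chainRange, mem_iUnion, mem_ofPred_eq, mem_Icc, exists_prop] at hx hy
    obtain ⟨i, ⟨hi, hil⟩, hx⟩ := hx
    obtain ⟨j, ⟨hj, hjl⟩, hy⟩ := hy
    refine ⟨max i j, ?_, mem_envSet.2 ⟨i, hi, le_max_left _ _, hx⟩,
      mem_envSet.2 ⟨j, hj, le_max_right _ _, hy⟩⟩
    rcases max_choice i j with hm | hm <;> rwa [hm]
  classical
  obtain ⟨s, hs, hmin⟩ : ∃ s : ℕ, ((s : ℕ∞) ≤ l ∧ x ∈ envSet a b s ∧ y ∈ envSet a b s) ∧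
      ∀ m < s, ¬((m : ℕ∞) ≤ l ∧ x ∈ envSet a b m ∧ y ∈ envSet a b m) :=
    ⟨Nat.find hex, Nat.find_spec hex, fun m => Nat.find_min hex⟩
  obtain ⟨hsl, hxs, hys⟩ := hs
  obtain _ | k := s
  · obtain ⟨j, h1, h0, _⟩ := mem_envSet.1 hxs
    omega
  have hk1 : 1 ≤ k + 1 := by omega
  have hkl : (k : ℕ∞) ≤ l := le_trans (by exact_mod_cast k.le_succ) hsl
  have hnew : x ∉ envSet a b k ∨ y ∉ envSet a b k := by
    have := hmin k k.lt_succ_self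
    tauto
  obtain ⟨⟨hab, hιab⟩, -, -, hc⟩ := h (k + 1) hk1 hsl
  have hxs' := (h.mem_envSet_iff hk1 hsl).1 hxs
  have hys' := (h.mem_envSet_iff hk1 hsl).1 hys
  have hboxs := h.box_mem_envSet hk1 hsl
  have hcases : (x ∉ envSet a b k ∧ x = a (k + 1) ∧ x = envA a b (k + 1)) ∨
      (y ∉ envSet a b k ∧ y = b (k + 1) ∧ y = envB a b (k + 1)) := by
    by_cases hx : x ∈ envSet a b k
    · have hy := hnew.resolve_left (not_not.2 hx)
      rcases (h.new_point hsl hys hy).1 with hA | hB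
      · exact absurd (show x = y by omega) fun e => hy (e ▸ hx)
      · exact .inr ⟨hy, hB⟩
    · rcases (h.new_point hsl hxs hx).1 with hA | hB
      · exact .inl ⟨hx, hA⟩
      · obtain rfl : x = y := by omega
        exact .inr ⟨hx, hB⟩
  refine ⟨k + 1, hk1, hsl, ?_⟩
  rcases hcases with ⟨hx, hxa, hxA⟩ | ⟨hy, hyb, hyB⟩
  · have hyb : y ≤ b (k + 1) := by
      rcases hc with ⟨-, hc⟩ | ⟨-, hc⟩
      · rw [hc]
        exact le_jminus hys'.2 (by rw [← hιxy, ← hxA])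
      · omega
    refine ⟨hxa.symm, hyb.eq_or_lt.elim Eq.symm fun hlt => ?_⟩
    obtain ⟨hyw, hιw⟩ := splus_mem hub y
    have hwb : splus ι y ≤ b (k + 1) := splus_le hlt (by rw [← hιab, ← hxa, hιxy])
    have hw : splus ι y ∈ envSet a b k := by
      refine (h.new_point hsl hxs hx).2 _ ((h.mem_envSet_iff hk1 hsl).2 ?_) (by omega)
      have := (h.mem_envSet_iff hk1 hsl).1 hboxs.2
      omega
    obtain ⟨t, ht1, htk, htl, ht⟩ := h.exists_endpoint hkl hw
    obtain ⟨htab, hιt⟩ := (h t ht1 htl).1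
    have hta := envSet_mono a b htk (h.box_mem_envSet ht1 htl).1
    have hxt : x < a t := by
      have := ((h.mem_envSet_iff hk1 hsl).1 (envSet_mono a b k.le_succ hta)).1
      have hne : x ≠ a t := fun e => hx (e ▸ hta)
      omega
    have hιxt : ι x = ι (a t) := by
      rcases ht with ht | ht
      · rw [← ht, hιw, hιxy]
      · rw [hιt, ← ht, hιw, hιxy]
    have := le_sminus hxt hιxt
    rcases hcomm t ht1 htl with hC | hC <;> omega
  · have hax : a (k + 1) ≤ x := by
      rcases hc with ⟨hc, -⟩ | ⟨hc, -⟩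
      · omega
      · rw [hc]
        exact jplus_le hxs'.1 (by rw [hιxy, ← hyB])
    refine ⟨hax.eq_or_lt.elim id fun hlt => ?_, hyb.symm⟩
    obtain ⟨hwx, hιw⟩ := sminus_mem hub x
    have haw : a (k + 1) ≤ sminus ι x := le_sminus hlt (by rw [hιab, ← hyb, hιxy])
    have hw : sminus ι x ∈ envSet a b k := by
      refine (h.new_point hsl hys hy).2 _ ((h.mem_envSet_iff hk1 hsl).2 ?_) (by omega)
      have := (h.mem_envSet_iff hk1 hsl).1 hboxs.1
      omega
    obtain ⟨t, ht1, htk, htl, ht⟩ := h.exists_endpoint hkl hw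
    obtain ⟨htab, hιt⟩ := (h t ht1 htl).1
    have htb := envSet_mono a b htk (h.box_mem_envSet ht1 htl).2
    have hty : b t < y := by
      have := ((h.mem_envSet_iff hk1 hsl).1 (envSet_mono a b k.le_succ htb)).2
      have hne : y ≠ b t := fun e => hy (e ▸ htb)
      omega
    have hιyt : ι y = ι (b t) := by
      rcases ht with ht | ht
      · rw [← hιt, ← ht, hιw, hιxy]
      · rw [← ht, hιw, hιxy]
    have := splus_le hty hιyt
    rcases hcomm t ht1 htl with hC | hC <;> omega
end

section
/- Let (𝔠ₖ)_{1≤k≤l} be an admissible chain of i-boxes of finite length l with range [ã_l, b̃_l]. If [a,b] is an i-box such that a⁻ < ã_l ≤ a and b ≤ b̃_l < b⁺ (equivalently a = ã_l(i)⁺ and b = b̃_l(i)⁻ where i = ι(a) = ι(b)), then [a,b] is a member of the chain, i.e. [a,b] = 𝔠ₛ for some 1 ≤ s ≤ l. -/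
open Set

variable {I : Type*}

lemma le_of_sminus_lt {ι : ℤ → I} {x A t : ℤ} (hx : sminus ι x < A) (hA : A ≤ t)
    (ht : ι t = ι x) : x ≤ t := by
  by_contra! hlt
  have : t ≤ sminus ι x := le_csSup ⟨x, fun s hs => hs.1.le⟩ ⟨hlt, ht⟩
  omega

lemma le_of_lt_splus {ι : ℤ → I} {y B t : ℤ} (hy : B < splus ι y) (hB : t ≤ B)
    (ht : ι t = ι y) : t ≤ y := by
  by_contra! hlt
  have : splus ι y ≤ t := csInf_le ⟨y, fun s hs => hs.1.le⟩ ⟨hlt, ht⟩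
  omega

lemma envSet_succ (a b : ℕ → ℤ) (k : ℕ) :
    envSet a b (k + 1) = envSet a b k ∪ Set.Icc (a (k + 1)) (b (k + 1)) := by
  ext t
  simp only [envSet, Set.mem_iUnion, Set.mem_union, exists_prop]
  constructor
  · rintro ⟨j, ⟨hj, hjk⟩, ht⟩
    rcases Nat.le_succ_iff.mp hjk with h | rfl
    · exact .inl ⟨j, ⟨hj, h⟩, ht⟩
    · exact .inr ht
  · rintro (⟨j, ⟨hj, hjk⟩, ht⟩ | ht)
    · exact ⟨j, ⟨hj, by omega⟩, ht⟩
    · exact ⟨k + 1, ⟨by omega, le_rfl⟩, ht⟩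

/-- A box of an admissible chain starting at the left end of the envelope, or ending at its right
end, is the largest i-box of its color in the envelope. -/
lemma eq_of_maximal_box {ι : ℤ → I} {a b A B x y : ℤ} (hab : IsIBox ι a b) (hxy : ι x = ι y)
    (hAx : A ≤ x) (hyB : y ≤ B)
    (hx : ∀ t, A ≤ t → ι t = ι x → x ≤ t) (hy : ∀ t, t ≤ B → ι t = ι y → t ≤ y)
    (hbox : (a = A ∧ b = jminus ι B (ι A)) ∨ (a = jplus ι A (ι B) ∧ b = B))
    (hend : (x = A ∧ a = A) ∨ (y = B ∧ b = B)) : a = x ∧ b = y := by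
  have hι := hab.2
  have hjm (h : ι A = ι y) : jminus ι B (ι A) = y :=
    IsGreatest.csSup_eq ⟨⟨hyB, h.symm⟩, fun t ht => hy t ht.1 (ht.2.trans h)⟩
  have hjp (h : ι B = ι x) : jplus ι A (ι B) = x :=
    IsLeast.csInf_eq ⟨⟨hAx, h.symm⟩, fun t ht => hx t ht.1 (ht.2.trans h)⟩
  rcases hend with ⟨rfl, ha⟩ | ⟨rfl, hb⟩
  · refine ⟨ha, ?_⟩
    rcases hbox with ⟨-, hb⟩ | ⟨-, rfl⟩
    · exact hb.trans (hjm hxy)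
    · exact le_antisymm (hy _ le_rfl (by rw [← hι, ha, hxy])) hyB
  · refine ⟨?_, hb⟩
    rcases hbox with ⟨rfl, -⟩ | ⟨ha, -⟩
    · exact le_antisymm hAx (hx _ le_rfl (by rw [hι, hb, hxy]))
    · exact ha.trans (hjp hxy.symm)

lemma exists_eq_of_maximal_box {ι : ℤ → I} {a b : ℕ → ℤ} {x y : ℤ} (hxy : IsIBox ι x y)
    (l : ℕ) (hl : 1 ≤ l) (h : IsAdmissibleChain ι (l : ℕ∞) a b)
    (hAx : envA a b l ≤ x) (hyB : y ≤ envB a b l)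
    (hx : ∀ t, envA a b l ≤ t → ι t = ι x → x ≤ t)
    (hy : ∀ t, t ≤ envB a b l → ι t = ι y → t ≤ y) :
    ∃ s : ℕ, 1 ≤ s ∧ s ≤ l ∧ a s = x ∧ b s = y := by
  induction l, hl using Nat.le_induction with
  | base =>
    obtain ⟨hab, -, hcard, hbox⟩ := h 1 le_rfl le_rfl
    have := hxy.1
    push_cast at hcard
    refine ⟨1, le_rfl, le_rfl, eq_of_maximal_box hab hxy.2 hAx hyB hx hy hbox ?_⟩
    rcases hbox with ⟨ha, -⟩ | ⟨-, hb⟩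
    · exact .inl ⟨by omega, ha⟩
    · exact .inr ⟨by omega, hb⟩
  | succ k hk ih =>
    obtain ⟨hab, henv, hcard, hbox⟩ := h (k + 1) (by omega) le_rfl
    have h' : IsAdmissibleChain ι (k : ℕ∞) a b := fun j hj hjk =>
      h j hj (hjk.trans (by exact_mod_cast k.le_succ))
    obtain ⟨-, henv', hcard', -⟩ := h' k hk le_rfl
    have hunion := envSet_succ a b k
    rw [henv, henv'] at hunion
    push_cast at hcard
    have hsub : Set.Icc (envA a b k) (envB a b k) ⊆
        Set.Icc (envA a b (k + 1)) (envB a b (k + 1)) := hunion ▸ Set.subset_union_left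
    have hsubc : Set.Icc (a (k + 1)) (b (k + 1)) ⊆
        Set.Icc (envA a b (k + 1)) (envB a b (k + 1)) := hunion ▸ Set.subset_union_right
    rw [Set.Icc_subset_Icc_iff (by omega)] at hsub
    rw [Set.Icc_subset_Icc_iff hab.1] at hsubc
    have hxle := hxy.1
    by_cases hend : (x = envA a b (k + 1) ∧ a (k + 1) = envA a b (k + 1)) ∨
        (y = envB a b (k + 1) ∧ b (k + 1) = envB a b (k + 1))
    · exact ⟨k + 1, by omega, le_rfl, eq_of_maximal_box hab hxy.2 hAx hyB hx hy hbox hend⟩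
    · have hA : envA a b (k + 1) ∈ Set.Icc (envA a b k) (envB a b k) ∪
          Set.Icc (a (k + 1)) (b (k + 1)) := hunion ▸ ⟨le_rfl, by omega⟩
      have hB : envB a b (k + 1) ∈ Set.Icc (envA a b k) (envB a b k) ∪
          Set.Icc (a (k + 1)) (b (k + 1)) := hunion ▸ ⟨by omega, le_rfl⟩
      simp only [Set.mem_union, Set.mem_Icc] at hA hB
      obtain ⟨s, hs, hsk, hsxy⟩ := ih h' (by omega) (by omega)
        (fun t ht => hx t (hsub.1.trans ht)) (fun t ht => hy t (ht.trans hsub.2))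
      exact ⟨s, hs, by omega, hsxy⟩

theorem stmt2 (ι : ℤ → I) (hub : FibersUnbounded ι)
    (l : ℕ) (hl : 1 ≤ l) (a b : ℕ → ℤ) (h : IsAdmissibleChain ι (l : ℕ∞) a b)
    (x y : ℤ) (hbox : IsIBox ι x y)
    (hx : sminus ι x < envA a b l ∧ envA a b l ≤ x)
    (hy : y ≤ envB a b l ∧ envB a b l < splus ι y) :
    ∃ s : ℕ, 1 ≤ s ∧ s ≤ l ∧ a s = x ∧ b s = y :=
  exists_eq_of_maximal_box hbox l hl h hx.2 hy.1
    (fun _ ht hι => le_of_sminus_lt hx.1 ht hι) (fun _ ht hι => le_of_lt_splus hy.2 ht hι)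
end

section
/- Let 𝔠 = (𝔠ₖ)_{1≤k≤l} be an admissible chain of i-boxes of finite length l, let 1 ≤ k₀ < l be such that 𝔠ₖ₀ is movable, and assume ι(ãₖ₀₊₁) ≠ ι(b̃ₖ₀₊₁), i.e. the envelope 𝔠̃ₖ₀₊₁ is not an i-box. Then the box move acts by transposing the two boxes: Bₖ₀(𝔠)ₖ = 𝔠_{τ(k)} for all 1 ≤ k ≤ l, where τ is the transposition of k₀ and k₀+1; in particular Bₖ₀(𝔠)ₖ = 𝔠ₖ for all k ∉ {k₀, k₀+1}. -/
open Set

variable {I : Type*}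

/-- `ãₖ` of the chain encoded by the pair `(a0, T)` (`T j = false` means `L`, `true` means `R`). -/
def eA (a0 : ℤ) (T : ℕ → Bool) (k : ℕ) : ℤ :=
  a0 - ((Finset.Ico 1 k).filter (fun j => T j = false)).card

/-- `b̃ₖ` of the chain encoded by the pair `(a0, T)`. -/
def eB (a0 : ℤ) (T : ℕ → Bool) (k : ℕ) : ℤ :=
  a0 + ((Finset.Ico 1 k).filter (fun j => T j = true)).card

/-- Left endpoint `aₖ` of the `k`-th box of the admissible chain encoded by `(a0, T)`:
`𝔠ₖ = {ãₖ,b̃ₖ]` if `Tₖ₋₁ = R`, and `𝔠ₖ = [ãₖ,b̃ₖ}` if `k = 1` or `Tₖ₋₁ = L`. -/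
noncomputable def chA (ι : ℤ → I) (a0 : ℤ) (T : ℕ → Bool) (k : ℕ) : ℤ :=
  if 2 ≤ k ∧ T (k - 1) = true then jplus ι (eA a0 T k) (ι (eB a0 T k)) else eA a0 T k

/-- Right endpoint `bₖ` of the `k`-th box of the admissible chain encoded by `(a0, T)`. -/
noncomputable def chB (ι : ℤ → I) (a0 : ℤ) (T : ℕ → Bool) (k : ℕ) : ℤ :=
  if 2 ≤ k ∧ T (k - 1) = true then eB a0 T k else jminus ι (eB a0 T k) (ι (eA a0 T k))

/-- `𝔠ₛ` is a movable box of the chain of length `l` encoded by `(a0, T)`. -/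
def Movable (l : ℕ) (T : ℕ → Bool) (s : ℕ) : Prop :=
  1 ≤ s ∧ s < l ∧ (s = 1 ∨ T (s - 1) ≠ T s)

/-- The new value `a′` after the box move at `s`. -/
def moveA (a0 : ℤ) (T : ℕ → Bool) (s : ℕ) : ℤ :=
  if s = 1 then (if T 1 = true then a0 + 1 else a0 - 1) else a0

/-- The new sequence `𝔗′` after the box move at `s` (flipping `T` at `s-1` and `s`;
when `s = 1`, flipping the irrelevant index `0` is harmless). -/
def moveT (T : ℕ → Bool) (s : ℕ) : ℕ → Bool :=
  fun k => if k = s - 1 ∨ k = s then !(T k) else T k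

section

variable (ι : ℤ → I) (a0 : ℤ) (T : ℕ → Bool) {k s : ℕ}

theorem jplus_self (x : ℤ) : jplus ι x (ι x) = x :=
  IsLeast.csInf_eq ⟨⟨le_rfl, rfl⟩, fun _ h => h.1⟩

theorem jminus_self (x : ℤ) : jminus ι x (ι x) = x :=
  IsGreatest.csSup_eq ⟨⟨le_rfl, rfl⟩, fun _ h => h.1⟩

variable {ι} in
theorem jplus_add_one {x : ℤ} {j : I} (h : ι x ≠ j) : jplus ι (x + 1) j = jplus ι x j := by
  unfold jplus
  congr 1
  ext t
  simp only [mem_ofPred_eq]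
  refine ⟨fun ht => ⟨by lia, ht.2⟩, fun ht => ⟨?_, ht.2⟩⟩
  have : x ≠ t := fun e => h (e ▸ ht.2)
  lia

variable {ι} in
theorem jminus_sub_one {x : ℤ} {j : I} (h : ι x ≠ j) : jminus ι (x - 1) j = jminus ι x j := by
  unfold jminus
  congr 1
  ext t
  simp only [mem_ofPred_eq]
  refine ⟨fun ht => ⟨by lia, ht.2⟩, fun ht => ⟨?_, ht.2⟩⟩
  have : x ≠ t := fun e => h (e ▸ ht.2)
  lia

theorem eA_one : eA a0 T 1 = a0 := by simp [eA]

theorem eB_one : eB a0 T 1 = a0 := by simp [eB]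

theorem eA_succ (hk : 1 ≤ k) :
    eA a0 T (k + 1) = eA a0 T k - if T k = true then 0 else 1 := by
  unfold eA
  rw [← Finset.insert_Ico_right_eq_Ico_add_one hk, Finset.filter_insert]
  cases h : T k <;> simp
  ring

theorem eB_succ (hk : 1 ≤ k) :
    eB a0 T (k + 1) = eB a0 T k + if T k = true then 1 else 0 := by
  unfold eB
  rw [← Finset.insert_Ico_right_eq_Ico_add_one hk, Finset.filter_insert]
  cases h : T k <;> simp
  ring

variable {T} in
/-- The box move at `s` shifts the `s`-th envelope by one and fixes all the others. -/
theorem env_move (hs : 1 ≤ s) (hT : s = 1 ∨ T (s - 1) ≠ T s) (hk : 1 ≤ k) :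
    eA (moveA a0 T s) (moveT T s) k =
        eA a0 T k + (if k = s then (if T s = true then 1 else -1) else 0) ∧
      eB (moveA a0 T s) (moveT T s) k =
        eB a0 T k + (if k = s then (if T s = true then 1 else -1) else 0) := by
  induction k, hk using Nat.le_induction with
  | base => simp only [eA_one, eB_one, moveA]; grind
  | succ k hk ih =>
    rw [eA_succ _ _ hk, eB_succ _ _ hk, eA_succ _ _ hk, eB_succ _ _ hk, ih.1, ih.2]
    simp only [moveT]
    grind

variable {T}

theorem box_eq_of_left (h : k = 1 ∨ T (k - 1) = false) :
    chA ι a0 T k = eA a0 T k ∧ chB ι a0 T k = jminus ι (eB a0 T k) (ι (eA a0 T k)) := by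
  have : ¬ (2 ≤ k ∧ T (k - 1) = true) := by grind
  simp only [chA, chB, if_neg this, and_self]

theorem box_eq_of_right (hk : 1 ≤ k) (h : k = 1 ∨ T (k - 1) = true) :
    chA ι a0 T k = jplus ι (eA a0 T k) (ι (eB a0 T k)) ∧ chB ι a0 T k = eB a0 T k := by
  rcases eq_or_ne k 1 with rfl | hk1
  · simp [chA, chB, eA_one, eB_one, jplus_self, jminus_self]
  · have : 2 ≤ k ∧ T (k - 1) = true := by grind
    simp only [chA, chB, if_pos this, and_self]

end

theorem stmt5 (ι : ℤ → I) (hub : FibersUnbounded ι)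
    (l : ℕ) (a0 : ℤ) (T : ℕ → Bool) (k₀ : ℕ) (hmov : Movable l T k₀)
    (hne : ι (eA a0 T (k₀ + 1)) ≠ ι (eB a0 T (k₀ + 1))) :
    ∀ k : ℕ, 1 ≤ k → k ≤ l →
      chA ι (moveA a0 T k₀) (moveT T k₀) k = chA ι a0 T (Equiv.swap k₀ (k₀ + 1) k) ∧
      chB ι (moveA a0 T k₀) (moveT T k₀) k = chB ι a0 T (Equiv.swap k₀ (k₀ + 1) k) := by
  intro k hk _
  obtain ⟨hs, -, hT⟩ := hmov
  have hk' := env_move a0 hs hT hk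
  have hAs := eA_succ a0 T hs
  have hBs := eB_succ a0 T hs
  rcases eq_or_ne k k₀ with rfl | hk₀
  · rw [Equiv.swap_apply_left]
    cases hTk : T k
    · obtain ⟨h1, h2⟩ := box_eq_of_left ι (moveA a0 T k) (T := moveT T k) (k := k)
        (by simp only [moveT]; grind)
      obtain ⟨h3, h4⟩ := box_eq_of_left ι a0 (T := T) (k := k + 1) (by grind)
      rw [h1, h2, h3, h4, hk'.1, hk'.2]
      simp only [hTk] at hAs hBs ⊢
      simp only [if_true, Bool.false_eq_true, if_false, add_zero] at hAs hBs ⊢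
      rw [← sub_eq_add_neg, ← sub_eq_add_neg, ← hAs, ← hBs, jminus_sub_one hne.symm]
      simp
    · obtain ⟨h1, h2⟩ := box_eq_of_right ι (moveA a0 T k) (T := moveT T k) hk
        (by simp only [moveT]; grind)
      obtain ⟨h3, h4⟩ := box_eq_of_right ι a0 (T := T) (k := k + 1) (by lia) (by grind)
      rw [h1, h2, h3, h4, hk'.1, hk'.2]
      simp only [hTk, if_true, sub_zero] at hAs hBs ⊢
      rw [← hAs, ← hBs, jplus_add_one hne]
      simp
  rcases eq_or_ne k (k₀ + 1) with rfl | hk₁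
  · rw [Equiv.swap_apply_right]
    simp only [if_neg hk₀, add_zero] at hk'
    cases hTk : T k₀
    · obtain ⟨h1, h2⟩ := box_eq_of_right ι (moveA a0 T k₀) (T := moveT T k₀) hk
        (by simp only [moveT]; grind)
      obtain ⟨h3, h4⟩ := box_eq_of_right ι a0 (T := T) hs (by grind)
      rw [h1, h2, h3, h4, hk'.1, hk'.2]
      simp only [hTk, Bool.false_eq_true, if_false, add_zero] at hAs hBs
      rw [← jplus_add_one hne, hAs, hBs]
      simp
    · obtain ⟨h1, h2⟩ := box_eq_of_left ι (moveA a0 T k₀) (T := moveT T k₀) (k := k₀ + 1)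
        (by simp only [moveT]; grind)
      obtain ⟨h3, h4⟩ := box_eq_of_left ι a0 (T := T) (k := k₀) (by grind)
      rw [h1, h2, h3, h4, hk'.1, hk'.2]
      simp only [hTk, if_true, sub_zero] at hAs hBs
      rw [← jminus_sub_one hne.symm, hAs, hBs]
      simp
  · rw [Equiv.swap_apply_of_ne_of_ne hk₀ hk₁]
    simp only [if_neg hk₀, add_zero] at hk'
    have hTk : 2 ≤ k → moveT T k₀ (k - 1) = T (k - 1) := by
      intro h
      simp only [moveT]
      grind
    have hc : (2 ≤ k ∧ moveT T k₀ (k - 1) = true) ↔ (2 ≤ k ∧ T (k - 1) = true) :=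
      and_congr_right fun h => by rw [hTk h]
    simp only [chA, chB, hk'.1, hk'.2, hc, and_self]
end

section
/- In an admissible chain of i-boxes (𝔠ₖ)_{1≤k≤l}, the i-boxes are pairwise distinct: if 1 ≤ j < k ≤ l (both finite), then 𝔠ⱼ ≠ 𝔠ₖ as subsets of ℤ. -/
open Set

variable {I : Type*}

/-- A box that repeats an earlier one does not enlarge the envelope. -/
theorem envSet_succ_eq_of_Icc_eq {a b : ℕ → ℤ} {j n : ℕ} (hj : 1 ≤ j) (hjn : j ≤ n)
    (heq : Set.Icc (a j) (b j) = Set.Icc (a (n + 1)) (b (n + 1))) :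
    envSet a b (n + 1) = envSet a b n := by
  refine Set.Subset.antisymm (Set.iUnion₂_subset fun i hi => ?_)
    (Set.biUnion_subset_biUnion_left (Set.Icc_subset_Icc_right n.le_succ))
  rcases Nat.le_succ_iff.mp hi.2 with hin | rfl
  · exact Set.subset_biUnion_of_mem (u := fun i => Set.Icc (a i) (b i))
      (show i ∈ Set.Icc 1 n from ⟨hi.1, hin⟩)
  · exact heq ▸ Set.subset_biUnion_of_mem (u := fun i => Set.Icc (a i) (b i))
      (show j ∈ Set.Icc 1 n from ⟨hj, hjn⟩)

theorem stmt10 (ι : ℤ → I) (hub : FibersUnbounded ι)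
    (l : ℕ∞) (a b : ℕ → ℤ) (h : IsAdmissibleChain ι l a b) :
    ∀ j k : ℕ, 1 ≤ j → j < k → (k : ℕ∞) ≤ l →
      Set.Icc (a j) (b j) ≠ Set.Icc (a k) (b k) := by
  intro j k hj hjk hkl heq
  obtain ⟨n, rfl⟩ : ∃ n, k = n + 1 := ⟨k - 1, by omega⟩
  have henv := envSet_succ_eq_of_Icc_eq hj (Nat.lt_succ_iff.mp hjk) heq
  have hnl : (n : ℕ∞) ≤ l := le_trans (by exact_mod_cast n.le_succ) hkl
  have hn := (h n (by omega) hnl).2.2.1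
  have hsucc := (h (n + 1) (by omega) hkl).2.2.1
  unfold envA envB at hn hsucc
  rw [henv] at hsucc
  push_cast at hsucc
  omega
end
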